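/- arXiv:0911.3173 — 2 statements merged into one kernel-verified Lean document; each statement's English description precedes it below -/
import Mathlib

section
/- Let T₁ and T₂ be G-trees admitting a collapse map f : T₁ → T₂. If T₁ and T₂ are not in the same deformation space (equivalently, T₂ does not dominate T₁), then some element of G is hyperbolic in T₁ and elliptic in T₂. -/
universe u v

/-- A `G`-tree: a nonempty simple graph which is a tree (connected and acyclic),
with a minimal action of `G` by graph automorphisms without inversions. -/
structure GTree (G : Type u) [Group G] : Type (u + 1) where
  V : Type u
  graph : SimpleGraph V
  nonempty : Nonempty V
  connected : graph.Connected
  acyclic : graph.IsAcyclic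
  act : G → V → V
  act_one : ∀ w, act 1 w = w
  act_mul : ∀ g h w, act (g * h) w = act g (act h w)
  act_adj : ∀ g a b, graph.Adj a b → graph.Adj (act g a) (act g b)
  noInversion : ∀ g a b, graph.Adj a b → ¬(act g a = b ∧ act g b = a)
  minimal : ∀ S : Set V, S.Nonempty → (∀ g, ∀ w ∈ S, act g w ∈ S) →
    (graph.induce S).Connected → S = Set.univ

namespace GTree

variable {G : Type u} [Group G]

/-- The stabilizer of a vertex. -/
def vertexStab (T : GTree G) (w : T.V) : Subgroup G where
  carrier := {g | T.act g w = w}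
  one_mem' := T.act_one w
  mul_mem' := by
    intro a b ha hb
    simp only [Set.mem_setOf_eq] at *
    rw [T.act_mul, hb, ha]
  inv_mem' := by
    intro a ha
    simp only [Set.mem_setOf_eq] at *
    calc T.act a⁻¹ w = T.act a⁻¹ (T.act a w) := by rw [ha]
    _ = T.act (a⁻¹ * a) w := (T.act_mul _ _ _).symm
    _ = w := by rw [inv_mul_cancel, T.act_one]

/-- The stabilizer of an edge `{u,v}`: elements fixing both endpoints. -/
def edgeStab (T : GTree G) (a b : T.V) : Subgroup G :=
  T.vertexStab a ⊓ T.vertexStab b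

/-- A subgroup is elliptic in `T` if it fixes a vertex. -/
def EllipticSubgroup (T : GTree G) (H : Subgroup G) : Prop :=
  ∃ w : T.V, ∀ h ∈ H, T.act h w = w

/-- An element is elliptic in `T` if it fixes a vertex (otherwise it is hyperbolic). -/
def EllipticElt (T : GTree G) (g : G) : Prop :=
  ∃ w : T.V, T.act g w = w

/-- `T₁` dominates `T₂`: every subgroup elliptic in `T₁` is elliptic in `T₂`. -/
def Dominates (T₁ T₂ : GTree G) : Prop :=
  ∀ H : Subgroup G, T₁.EllipticSubgroup H → T₂.EllipticSubgroup H

/-- `T` is an `𝒜`-tree: all its edge stabilizers belong to `𝒜`. -/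
def IsATree (T : GTree G) (𝒜 : Set (Subgroup G)) : Prop :=
  ∀ a b : T.V, T.graph.Adj a b → T.edgeStab a b ∈ 𝒜

/-- A subgroup is universally elliptic if it is elliptic in every `𝒜`-tree. -/
def UnivEllipticSubgroup (𝒜 : Set (Subgroup G)) (H : Subgroup G) : Prop :=
  ∀ T : GTree G, T.IsATree 𝒜 → T.EllipticSubgroup H

/-- An `𝒜`-tree is universally elliptic if all its edge stabilizers are universally elliptic. -/
def UnivEllipticTree (T : GTree G) (𝒜 : Set (Subgroup G)) : Prop :=
  ∀ a b : T.V, T.graph.Adj a b → UnivEllipticSubgroup 𝒜 (T.edgeStab a b)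

/-- A JSJ tree of `G` over `𝒜`: a universally elliptic `𝒜`-tree dominating every
universally elliptic `𝒜`-tree. -/
def IsJSJ (T : GTree G) (𝒜 : Set (Subgroup G)) : Prop :=
  T.IsATree 𝒜 ∧ T.UnivEllipticTree 𝒜 ∧
    ∀ T' : GTree G, T'.IsATree 𝒜 → T'.UnivEllipticTree 𝒜 → T.Dominates T'

/-- A collapse map `T → T'`: a `G`-equivariant surjection on vertices sending adjacent
vertices to adjacent or equal vertices, with connected point preimages. -/
def IsCollapseMap (T T' : GTree G) (f : T.V → T'.V) : Prop :=
  (∀ g w, f (T.act g w) = T'.act g (f w)) ∧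
    Function.Surjective f ∧
    (∀ a b : T.V, T.graph.Adj a b → f a = f b ∨ T'.graph.Adj (f a) (f b)) ∧
    ∀ w : T'.V, (T.graph.induce (f ⁻¹' {w})).Connected

end GTree

/-- `𝒜` is closed under conjugation and under passing to subgroups. -/
def ClosedFamily {G : Type u} [Group G] (𝒜 : Set (Subgroup G)) : Prop :=
  (∀ H ∈ 𝒜, ∀ g : G, Subgroup.map (MulAut.conj g).toMonoidHom H ∈ 𝒜) ∧
    ∀ H ∈ 𝒜, ∀ K : Subgroup G, K ≤ H → K ∈ 𝒜

/-- `G` is finitely presented: it admits a presentation with finitely many generators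
and finitely many relations. -/
def FinitelyPresentedGroup (G : Type u) [Group G] : Prop :=
  ∃ (n : ℕ) (rels : Set (FreeGroup (Fin n))),
    rels.Finite ∧ Nonempty (PresentedGroup rels ≃* G)

/-- `T` is an `(𝒜,ℋ)`-tree: an `𝒜`-tree in which every subgroup in `ℋ` is elliptic. -/
def RelATree {G : Type u} [Group G] (𝒜 ℋ : Set (Subgroup G)) (T : GTree G) : Prop :=
  T.IsATree 𝒜 ∧ ∀ H ∈ ℋ, T.EllipticSubgroup H

/-- A subgroup is universally elliptic relative to `ℋ` if it is elliptic in every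
`(𝒜,ℋ)`-tree. -/
def RelUnivEllipticSubgroup {G : Type u} [Group G] (𝒜 ℋ : Set (Subgroup G))
    (K : Subgroup G) : Prop :=
  ∀ T : GTree G, RelATree 𝒜 ℋ T → T.EllipticSubgroup K

/-- An `(𝒜,ℋ)`-tree is universally elliptic if all its edge stabilizers are universally
elliptic relative to `ℋ`. -/
def RelUnivEllipticTree {G : Type u} [Group G] (𝒜 ℋ : Set (Subgroup G))
    (T : GTree G) : Prop :=
  ∀ a b : T.V, T.graph.Adj a b → RelUnivEllipticSubgroup 𝒜 ℋ (T.edgeStab a b)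

/-- A JSJ tree of `G` over `𝒜` relative to `ℋ`. -/
def IsRelJSJ {G : Type u} [Group G] (𝒜 ℋ : Set (Subgroup G)) (T : GTree G) : Prop :=
  RelATree 𝒜 ℋ T ∧ RelUnivEllipticTree 𝒜 ℋ T ∧
    ∀ T' : GTree G, RelATree 𝒜 ℋ T' → RelUnivEllipticTree 𝒜 ℋ T' → T.Dominates T'

/-- The family of groups `F, H₁, …, H_p` whose free product is used to define relative
finite presentability. -/
def relFam {G : Type u} [Group G] {p : ℕ} (H : Fin p → Subgroup G) (n : ℕ) :
    Option (Fin p) → Type u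
  | none => FreeGroup (ULift.{u} (Fin n))
  | some j => H j

instance relFamGroup {G : Type u} [Group G] {p : ℕ} (H : Fin p → Subgroup G) (n : ℕ) :
    (i : Option (Fin p)) → Group (relFam H n i)
  | none => inferInstanceAs (Group (FreeGroup _))
  | some j => inferInstanceAs (Group (H j))

/-- `G` is finitely presented relative to `H₁, …, H_p`: there is a surjection from
`F ∗ H₁ ∗ ⋯ ∗ H_p` (with `F` a finitely generated free group) onto `G` restricting to
the inclusion on each `Hᵢ`, whose kernel is the normal closure of a finite subset. -/
def RelFinitelyPresented {G : Type u} [Group G] {p : ℕ} (H : Fin p → Subgroup G) : Prop :=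
  ∃ (n : ℕ) (φ : Monoid.CoprodI (relFam H n) →* G),
    Function.Surjective φ ∧
    (∀ (j : Fin p) (h : H j), φ (Monoid.CoprodI.of (M := relFam H n) (i := some j) h) = (h : G)) ∧
    ∃ s : Set (Monoid.CoprodI (relFam H n)), s.Finite ∧
      MonoidHom.ker φ = Subgroup.normalClosure s

/-- `S` has a single orbit of edges. -/
def OneEdgeOrbit {G : Type u} [Group G] (S : GTree G) : Prop :=
  ∀ e₁ ∈ S.graph.edgeSet, ∀ e₂ ∈ S.graph.edgeSet, ∃ g : G, Sym2.map (S.act g) e₁ = e₂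

/-- `G` splits over `K`: there is a nontrivial `G`-tree with a single orbit of edges
having `K` as an edge stabilizer. -/
def SplitsOver {G : Type u} [Group G] (K : Subgroup G) : Prop :=
  ∃ S : GTree G, Nontrivial S.V ∧ OneEdgeOrbit S ∧
    ∃ x y : S.V, S.graph.Adj x y ∧ S.edgeStab x y = K

/-- A subgroup is slender if all its subgroups are finitely generated. -/
def SlenderSubgroup {G : Type u} [Group G] (H : Subgroup G) : Prop :=
  ∀ K : Subgroup G, K ≤ H → K.FG

/-- A subgroup is abelian. -/
def AbelianSubgroup {G : Type u} [Group G] (H : Subgroup G) : Prop :=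
  ∀ a ∈ H, ∀ b ∈ H, a * b = b * a

/-- `H` is malnormal in `G`: `gHg⁻¹ ∩ H ≠ {1}` implies `g ∈ H`. -/
def Malnormal {G : Type u} [Group G] (H : Subgroup G) : Prop :=
  ∀ g : G, (∃ x ∈ H, x ≠ 1 ∧ g * x * g⁻¹ ∈ H) → g ∈ H

/-- `G` is CSA: the centralizer of every nontrivial element is abelian and malnormal. -/
def IsCSA (G : Type u) [Group G] : Prop :=
  ∀ g : G, g ≠ 1 →
    AbelianSubgroup (Subgroup.centralizer {g}) ∧ Malnormal (Subgroup.centralizer {g})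

namespace SimpleGraph

variable {V : Type*} {Γ : SimpleGraph V}

lemma IsAcyclic.length_eq_dist_of_isPath (hΓ : Γ.IsAcyclic) {a b : V} {p : Γ.Walk a b}
    (hp : p.IsPath) : p.length = Γ.dist a b := by
  obtain ⟨q, hq, hql⟩ := p.reachable.exists_path_of_dist
  have h : p = q := congrArg Subtype.val ((hΓ.subsingleton_path a b).elim ⟨p, hp⟩ ⟨q, hq⟩)
  rw [h, hql]

/-- In a tree, the path from `a` to `b` visits each `m` between them at time `dist a m`. -/
lemma IsTree.getVert_of_isPath (hΓ : Γ.IsTree) {a b m : V} {p : Γ.Walk a b} (hp : p.IsPath)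
    (hm : Γ.dist a m + Γ.dist m b = Γ.dist a b) : p.getVert (Γ.dist a m) = m := by
  obtain ⟨q, hq⟩ := hΓ.connected.exists_walk_length_eq_dist a m
  obtain ⟨r, hr⟩ := hΓ.connected.exists_walk_length_eq_dist m b
  have hqr : (q.append r).IsPath :=
    Walk.isPath_of_length_eq_dist _ (by rw [Walk.length_append, hq, hr, hm])
  have h : p = q.append r :=
    congrArg Subtype.val ((hΓ.isAcyclic.subsingleton_path a b).elim ⟨p, hp⟩ ⟨_, hqr⟩)
  rw [h, ← hq, Walk.getVert_append]
  simp

lemma IsTree.mem_support_of_dist_add_dist (hΓ : Γ.IsTree) {a b m : V} {p : Γ.Walk a b}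
    (hp : p.IsPath) (hm : Γ.dist a m + Γ.dist m b = Γ.dist a b) : m ∈ p.support :=
  hΓ.getVert_of_isPath hp hm ▸ p.getVert_mem_support _

lemma IsTree.eq_of_dist_eq (hΓ : Γ.IsTree) {a b m n : V}
    (hm : Γ.dist a m + Γ.dist m b = Γ.dist a b) (hn : Γ.dist a n + Γ.dist n b = Γ.dist a b)
    (hmn : Γ.dist a m = Γ.dist a n) : m = n := by
  obtain ⟨p, hp, -⟩ := hΓ.connected.exists_path_of_dist a b
  rw [← hΓ.getVert_of_isPath hp hm, ← hΓ.getVert_of_isPath hp hn, hmn]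

lemma IsTree.mem_of_dist_add_dist (hΓ : Γ.IsTree) {S : Set V} (hS : (Γ.induce S).Connected)
    {a b m : V} (ha : a ∈ S) (hb : b ∈ S) (hm : Γ.dist a m + Γ.dist m b = Γ.dist a b) :
    m ∈ S := by
  obtain ⟨p, hp, -⟩ := hS.exists_path_of_dist ⟨a, ha⟩ ⟨b, hb⟩
  have hq : (p.map (Embedding.induce S).toHom).IsPath :=
    hp.map (Embedding.induce (G := Γ) S).injective
  have h := hΓ.mem_support_of_dist_add_dist hq hm
  rw [Walk.support_map, List.mem_map] at h
  obtain ⟨x, -, rfl⟩ := h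
  exact x.2

/-- Three vertices of a tree have a median. -/
lemma IsTree.exists_median (hΓ : Γ.IsTree) (x y z : V) :
    ∃ m, Γ.dist z m + Γ.dist m x = Γ.dist z x ∧ Γ.dist z m + Γ.dist m y = Γ.dist z y ∧
      Γ.dist x m + Γ.dist m y = Γ.dist x y := by
  have hc := hΓ.connected
  obtain ⟨m, ⟨hmx, hmy⟩, hmax⟩ : ∃ m,
      (Γ.dist z m + Γ.dist m x = Γ.dist z x ∧ Γ.dist z m + Γ.dist m y = Γ.dist z y) ∧
      ∀ w, Γ.dist z w + Γ.dist w x = Γ.dist z x ∧ Γ.dist z w + Γ.dist w y = Γ.dist z y →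
        Γ.dist z w ≤ Γ.dist z m := by
    let A : Set ℕ := {n | ∃ m, (Γ.dist z m + Γ.dist m x = Γ.dist z x ∧
      Γ.dist z m + Γ.dist m y = Γ.dist z y) ∧ Γ.dist z m = n}
    have hne : A.Nonempty := ⟨0, z, by simp⟩
    have hbdd : BddAbove A := ⟨Γ.dist z x, by rintro n ⟨m, ⟨h, -⟩, rfl⟩; omega⟩
    obtain ⟨m, hm, hmA⟩ := Nat.sSup_mem hne hbdd
    exact ⟨m, hm, fun w hw ↦ hmA ▸ le_csSup hbdd ⟨w, hw, rfl⟩⟩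
  refine ⟨m, hmx, hmy, ?_⟩
  obtain ⟨p, hp, hpl⟩ := hc.exists_path_of_dist x m
  obtain ⟨q, hq, hql⟩ := hc.exists_path_of_dist m y
  have hpq : (p.append q).IsPath := by
    rw [Walk.isPath_def, Walk.support_append, List.nodup_append']
    refine ⟨hp.support_nodup, hq.support_nodup.tail, fun w hwp hwq ↦ ?_⟩
    have hwq' : w ∈ q.support := List.mem_of_mem_tail hwq
    have between {a b : V} {r : Γ.Walk a b} (hr : r.length = Γ.dist a b) (hw : w ∈ r.support) :
        Γ.dist a w + Γ.dist w b = Γ.dist a b := by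
      classical
      have h := congrArg Walk.length (r.take_spec hw)
      rw [Walk.length_append] at h
      have h₁ := Γ.dist_le (r.takeUntil w hw)
      have h₂ := Γ.dist_le (r.dropUntil w hw)
      have h₃ := hc.dist_triangle (u := a) (v := w) (w := b)
      omega
    have h₁ := between hpl hwp
    have h₂ := between hql hwq'
    have e₁ := Γ.dist_comm (u := x) (v := w)
    have e₂ := Γ.dist_comm (u := x) (v := m)
    have e₃ := Γ.dist_comm (u := w) (v := m)
    have t₀ := hc.dist_triangle (u := z) (v := m) (w := w)
    have t₁ := hc.dist_triangle (u := z) (v := w) (w := x)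
    have t₂ := hc.dist_triangle (u := z) (v := w) (w := y)
    have h₃ := hmax w ⟨by omega, by omega⟩
    have h₄ : Γ.dist m w = 0 := by omega
    obtain rfl := hc.dist_eq_zero_iff.1 h₄
    have h₅ := hq.support_nodup
    rw [← Walk.cons_tail_support, List.nodup_cons] at h₅
    exact h₅.1 hwq
  rw [← hΓ.isAcyclic.length_eq_dist_of_isPath hpq, Walk.length_append, hpl, hql]

lemma Connected.exists_adj_dist_add_one (hΓ : Γ.Connected) {a b : V} (hab : a ≠ b) :
    ∃ n, Γ.Adj a n ∧ Γ.dist n b + 1 = Γ.dist a b := by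
  obtain ⟨p, hp⟩ := hΓ.exists_walk_length_eq_dist a b
  cases p with
  | nil => exact absurd rfl hab
  | @cons _ n _ h q =>
    refine ⟨n, h, ?_⟩
    have h₁ := Γ.dist_le q
    have h₂ := hΓ.dist_triangle (u := a) (v := n) (w := b)
    rw [dist_eq_one_iff_adj.2 h] at h₂
    rw [Walk.length_cons] at hp
    omega

section Action

variable {H : Type*} [Group H] [MulAction H V]

lemma Connected.dist_smul_smul (hΓ : Γ.Connected)
    (hadj : ∀ (h : H) a b, Γ.Adj a b → Γ.Adj (h • a) (h • b))
    (h : H) (a b : V) : Γ.dist (h • a) (h • b) = Γ.dist a b := by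
  have hle (h : H) (a b : V) : Γ.dist (h • a) (h • b) ≤ Γ.dist a b := by
    obtain ⟨p, hp⟩ := hΓ.exists_walk_length_eq_dist a b
    rw [← hp, ← p.length_map ⟨(h • ·), hadj h _ _⟩]
    exact Γ.dist_le _
  refine le_antisymm (hle h a b) ?_
  simpa using hle h⁻¹ (h • a) (h • b)

/-- An automorphism of a tree fixing the ends of a path fixes the path pointwise. -/
lemma IsTree.smul_eq_of_dist_add_dist (hΓ : Γ.IsTree)
    (hadj : ∀ (h : H) a b, Γ.Adj a b → Γ.Adj (h • a) (h • b)) {h : H} {a b m : V}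
    (ha : h • a = a) (hb : h • b = b) (hm : Γ.dist a m + Γ.dist m b = Γ.dist a b) :
    h • m = m := by
  have h₁ := hΓ.connected.dist_smul_smul hadj h a m
  have h₂ := hΓ.connected.dist_smul_smul hadj h m b
  rw [ha] at h₁
  rw [hb] at h₂
  exact hΓ.eq_of_dist_eq (a := a) (b := b) (by omega) hm h₁

/-- An automorphism fixing a vertex fixes a vertex of each invariant subtree. -/
lemma IsTree.exists_mem_smul_eq (hΓ : Γ.IsTree)
    (hadj : ∀ (h : H) a b, Γ.Adj a b → Γ.Adj (h • a) (h • b)) {h : H} {S : Set V}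
    (hS : (Γ.induce S).Connected) (hinv : ∀ a ∈ S, h • a ∈ S) {p : V} (hp : h • p = p) :
    ∃ y ∈ S, h • y = y := by
  obtain ⟨⟨y₀, hy₀⟩⟩ := hS.nonempty
  obtain ⟨y, hyS, hmin⟩ := exists_minimalFor_of_wellFoundedLT (· ∈ S) (Γ.dist p) ⟨y₀, hy₀⟩
  obtain ⟨m, h₁, h₂, h₃⟩ := hΓ.exists_median y (h • y) p
  have hmS := hΓ.mem_of_dist_add_dist hS hyS (hinv y hyS) h₃
  have h₄ := hΓ.connected.dist_smul_smul hadj h p y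
  rw [hp] at h₄
  have h₅ : Γ.dist p y ≤ Γ.dist p m := by
    by_contra hlt
    exact hlt (hmin hmS (by omega))
  have h₆ : m = y := hΓ.connected.dist_eq_zero_iff.1 (by omega)
  have h₇ : m = h • y := hΓ.connected.dist_eq_zero_iff.1 (by omega)
  exact ⟨y, hyS, h₇.symm.trans h₆⟩

/-- An elliptic automorphism fixes the midpoint between a vertex and its image. -/
lemma IsTree.exists_midpoint_smul_eq (hΓ : Γ.IsTree)
    (hadj : ∀ (h : H) a b, Γ.Adj a b → Γ.Adj (h • a) (h • b)) {h : H}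
    (hell : ∃ q : V, h • q = q) (p : V) :
    ∃ q, h • q = q ∧ Γ.dist p q + Γ.dist q (h • p) = Γ.dist p (h • p) ∧
      Γ.dist p q = Γ.dist q (h • p) := by
  obtain ⟨q, hq, hmin⟩ := exists_minimalFor_of_wellFoundedLT (fun q ↦ h • q = q) (Γ.dist p) hell
  obtain ⟨m, h₁, h₂, h₃⟩ := hΓ.exists_median p (h • p) q
  have h₄ := hΓ.connected.dist_smul_smul hadj h q p
  have h₅ := hΓ.connected.dist_smul_smul hadj h q m
  have h₆ := hΓ.connected.dist_smul_smul hadj h m p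
  rw [hq] at h₄ h₅
  have hm : h • m = m := hΓ.eq_of_dist_eq (a := q) (b := h • p) (by omega) h₂ h₅
  have e₁ := Γ.dist_comm (u := p) (v := m)
  have e₂ := Γ.dist_comm (u := p) (v := q)
  have h₇ : Γ.dist p q ≤ Γ.dist p m := by
    by_contra hlt
    exact hlt (hmin hm (by omega))
  obtain rfl : q = m := hΓ.connected.dist_eq_zero_iff.1 (by omega)
  exact ⟨q, hq, h₃, by omega⟩

/-- Serre's lemma: if `g`, `h` and `g * h` are elliptic, then `g` and `h` have a common fixed
vertex. -/
lemma IsTree.exists_common_fixed (hΓ : Γ.IsTree)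
    (hadj : ∀ (h : H) a b, Γ.Adj a b → Γ.Adj (h • a) (h • b)) {g h : H}
    (hg : ∃ q : V, g • q = q) (hh : ∃ q : V, h • q = q) (hgh : ∃ q : V, (g * h) • q = q) :
    ∃ q : V, g • q = q ∧ h • q = q := by
  obtain ⟨p, hp⟩ := hgh
  have hp' : g⁻¹ • p = h • p := by rw [inv_smul_eq_iff, smul_smul, hp]
  obtain ⟨q, hq, hq₁, hq₂⟩ := hΓ.exists_midpoint_smul_eq hadj hh p
  obtain ⟨r, hr, hr₁, hr₂⟩ := hΓ.exists_midpoint_smul_eq hadj (h := g⁻¹)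
    (hg.imp fun q hq ↦ by rw [inv_smul_eq_iff, hq]) p
  rw [hp'] at hr₁ hr₂
  obtain rfl : q = r := hΓ.eq_of_dist_eq hq₁ hr₁ (by omega)
  exact ⟨q, by rwa [inv_smul_eq_iff, eq_comm] at hr, hq⟩

/-- The first edge from `v` towards a vertex fixed by `h` does not depend on the fixed vertex,
if `h` moves `v`. -/
lemma IsTree.dist_add_one_of_fixed (hΓ : Γ.IsTree)
    (hadj : ∀ (h : H) a b, Γ.Adj a b → Γ.Adj (h • a) (h • b)) {h : H} {v n q r : V}
    (hv : h • v ≠ v) (hq : h • q = q) (hr : h • r = r) (hn : Γ.Adj v n)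
    (hnq : Γ.dist n q + 1 = Γ.dist v q) : Γ.dist n r + 1 = Γ.dist v r := by
  have hc := hΓ.connected
  obtain ⟨m, h₁, h₂, h₃⟩ := hΓ.exists_median q r v
  have hm : h • m = m := hΓ.smul_eq_of_dist_add_dist hadj hq hr h₃
  have hvm : v ≠ m := by rintro rfl; exact hv hm
  obtain ⟨n', hn', hnm⟩ := hc.exists_adj_dist_add_one hvm
  have d := dist_eq_one_iff_adj.2 hn
  have d' := dist_eq_one_iff_adj.2 hn'
  have t₁ := hc.dist_triangle (u := n') (v := m) (w := q)
  have t₂ := hc.dist_triangle (u := v) (v := n') (w := q)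
  obtain rfl : n = n' := hΓ.eq_of_dist_eq (a := v) (b := q) (by omega) (by omega) (by omega)
  have t₃ := hc.dist_triangle (u := n) (v := m) (w := r)
  have t₄ := hc.dist_triangle (u := v) (v := n) (w := r)
  omega

/-- A group acting on a tree with no global fixed vertex, all of whose elements are elliptic,
moves vertices equivariantly towards a fixed end. -/
lemma IsTree.exists_equivariant_shift (hΓ : Γ.IsTree)
    (hadj : ∀ (h : H) a b, Γ.Adj a b → Γ.Adj (h • a) (h • b))
    (hell : ∀ h : H, ∃ q : V, h • q = q) (hfix : ∀ v : V, ∃ h : H, h • v ≠ v) :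
    ∃ π : V → V, (∀ (h : H) v, π (h • v) = h • π v) ∧
      ∀ (h : H) v q, h • v ≠ v → h • q = q → Γ.dist (π v) q + 1 = Γ.dist v q := by
  have key (v : V) : ∃ n, Γ.Adj v n ∧
      ∀ (h : H) q, h • v ≠ v → h • q = q → Γ.dist n q + 1 = Γ.dist v q := by
    obtain ⟨h₀, hv⟩ := hfix v
    obtain ⟨q₀, hq₀⟩ := hell h₀
    have hne : v ≠ q₀ := by rintro rfl; exact hv hq₀
    obtain ⟨n, hn, hnq⟩ := hΓ.connected.exists_adj_dist_add_one hne
    refine ⟨n, hn, fun h q hhv hhq ↦ ?_⟩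
    obtain ⟨r, hr₀, hr⟩ := hΓ.exists_common_fixed hadj (hell h₀) (hell h) (hell (h₀ * h))
    exact hΓ.dist_add_one_of_fixed hadj hhv hr hhq hn
      (hΓ.dist_add_one_of_fixed hadj hv hq₀ hr₀ hn hnq)
  choose π hπ hπd using key
  refine ⟨π, fun g v ↦ ?_, fun h v q ↦ hπd v h q⟩
  obtain ⟨h, hv⟩ := hfix (g • v)
  obtain ⟨q, hq⟩ := hell h
  have h₁ := hπd _ h q hv hq
  have h₂ := hπd v (g⁻¹ * h * g) (g⁻¹ • q)
    (by rwa [mul_smul, mul_smul, Ne, inv_smul_eq_iff]) (by simp [mul_smul, hq])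
  have h₃ := hΓ.connected.dist_smul_smul hadj g (π v) (g⁻¹ • q)
  have h₄ := hΓ.connected.dist_smul_smul hadj g v (g⁻¹ • q)
  rw [smul_inv_smul] at h₃ h₄
  have d₁ := dist_eq_one_iff_adj.2 (hπ (g • v))
  have d₂ := dist_eq_one_iff_adj.2 (hadj g _ _ (hπ v))
  exact hΓ.eq_of_dist_eq (a := g • v) (b := q) (by omega) (by omega) (by omega)

/-- A group acting on a tree with finitely many orbits of vertices, all of whose elements are
elliptic, has a global fixed vertex. -/
lemma IsTree.exists_fixed_of_forall_elliptic (hΓ : Γ.IsTree)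
    (hadj : ∀ (h : H) a b, Γ.Adj a b → Γ.Adj (h • a) (h • b))
    (hell : ∀ h : H, ∃ q : V, h • q = q) {ι : Type*} [Finite ι] (c : V → ι)
    (hc : ∀ a b, c a = c b → ∃ h : H, h • a = b) : ∃ v : V, ∀ h : H, h • v = v := by
  by_contra! hfix
  obtain ⟨π, hπ, hπd⟩ := hΓ.exists_equivariant_shift hadj hell hfix
  have hiter (n : ℕ) (h : H) (v : V) : π^[n] (h • v) = h • π^[n] v := by
    induction n generalizing v with
    | zero => rfl
    | succ n ih => rw [Function.iterate_succ_apply, hπ, ih, Function.iterate_succ_apply]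
  have hdist (x : V) (k : ℕ) : k ≤ Γ.dist x (π^[k] x) := by
    obtain ⟨h, hh⟩ := hfix (π^[k] x)
    obtain ⟨q, hq⟩ := hell h
    have hmove (i : ℕ) (hi : i ≤ k) : h • π^[i] x ≠ π^[i] x := fun hi' ↦ hh <| by
      obtain ⟨j, rfl⟩ := Nat.exists_eq_add_of_le' hi
      rw [Function.iterate_add_apply, ← hiter, hi']
    have hdec (i : ℕ) (hi : i ≤ k) : Γ.dist (π^[i] x) q + i = Γ.dist x q := by
      induction i with
      | zero => rfl
      | succ i ih =>
        have h₁ := hπd h (π^[i] x) q (hmove i (by omega)) hq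
        have h₂ := ih (by omega)
        rw [Function.iterate_succ_apply']
        omega
    have h₁ := hdec k le_rfl
    have h₂ := hΓ.connected.dist_triangle (u := x) (v := π^[k] x) (w := q)
    omega
  obtain ⟨x₀⟩ := hΓ.connected.nonempty
  obtain ⟨i, j, hij, hcij⟩ : ∃ i j : ℕ, i < j ∧ c (π^[i] x₀) = c (π^[j] x₀) := by
    obtain ⟨i, j, hne, h⟩ := Finite.exists_ne_map_eq_of_infinite fun i : ℕ ↦ c (π^[i] x₀)
    rcases lt_or_gt_of_ne hne with hlt | hlt
    exacts [⟨i, j, hlt, h⟩, ⟨j, i, hlt, h.symm⟩]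
  obtain ⟨g, hg⟩ := hc _ _ hcij
  obtain ⟨n, rfl⟩ := Nat.exists_eq_add_of_le' hij.le
  rw [Function.iterate_add_apply] at hg
  generalize π^[i] x₀ = x at hg
  obtain ⟨p, hp⟩ := hell g
  have hpow (k : ℕ) : π^[n * k] x = g ^ k • x := by
    induction k with
    | zero => simp
    | succ k ih => rw [mul_add_one, add_comm, Function.iterate_add_apply, ih, hiter, ← hg,
        smul_smul, pow_succ]
  have hfixp (k : ℕ) : g ^ k • p = p := by
    induction k with
    | zero => simp
    | succ k ih => rw [pow_succ, mul_smul, hp, ih]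
  set k := 2 * Γ.dist x p + 1 with hk
  have h₁ := hdist x (n * k)
  rw [hpow] at h₁
  have h₂ := hΓ.connected.dist_smul_smul hadj (g ^ k) p x
  rw [hfixp] at h₂
  have h₃ := hΓ.connected.dist_triangle (u := x) (v := p) (w := g ^ k • x)
  have h₄ := Γ.dist_comm (u := x) (v := p)
  have h₅ : k ≤ n * k := Nat.le_mul_of_pos_left k (by omega)
  omega

end Action

end SimpleGraph

namespace GTree

variable {G : Type u} [Group G]

instance (T : GTree G) : MulAction G T.V where
  smul := T.act
  one_smul := T.act_one
  mul_smul := T.act_mul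

lemma isTree (T : GTree G) : T.graph.IsTree := ⟨T.connected, T.acyclic⟩

lemma adj_smul (T : GTree G) (g : G) (a b : T.V) :
    T.graph.Adj a b → T.graph.Adj (g • a) (g • b) := T.act_adj g a b

/-- A finitely generated group acts on a minimal tree with finitely many orbits of vertices. -/
lemma exists_finite_smul_mem (hfg : Group.FG G) (T : GTree G) :
    ∃ F : Set T.V, F.Finite ∧ ∀ v, ∃ g : G, g • v ∈ F := by
  obtain ⟨S, hS⟩ := hfg.out
  obtain ⟨w⟩ := T.nonempty
  have hwalk (s : G) : Nonempty (T.graph.Walk w (s • w)) := T.connected w (s • w)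
  let p (s : G) : T.graph.Walk w (s • w) := (hwalk s).some
  let F : Set T.V := insert w (⋃ s ∈ S, {v | v ∈ (p s).support})
  have hF : F.Finite := (S.finite_toSet.biUnion fun s _ ↦ (p s).support.finite_toSet).insert w
  let X : Set T.V := {v | ∃ g : G, g • v ∈ F}
  have hFX : F ⊆ X := fun v hv ↦ ⟨1, by rwa [one_smul]⟩
  have hX (g : G) (v : T.V) (hv : v ∈ X) : g • v ∈ X := by
    obtain ⟨k, hk⟩ := hv
    exact ⟨k * g⁻¹, by rwa [smul_smul, inv_mul_cancel_right]⟩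
  let R (a b : T.V) : Prop := ∃ q : T.graph.Walk a b, ∀ u ∈ q.support, u ∈ X
  have hRsymm {a b : T.V} : R a b → R b a := fun ⟨q, hq⟩ ↦
    ⟨q.reverse, fun u hu ↦ hq u (by simpa using hu)⟩
  have hRtrans {a b c : T.V} : R a b → R b c → R a c := fun ⟨q, hq⟩ ⟨r, hr⟩ ↦
    ⟨q.append r, fun u hu ↦ (SimpleGraph.Walk.mem_support_append_iff _ _).1 hu |>.elim
      (hq u) (hr u)⟩
  have hRsmul (g : G) {a b : T.V} : R a b → R (g • a) (g • b) := fun ⟨q, hq⟩ ↦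
    ⟨q.map ⟨(g • ·), T.adj_smul g _ _⟩, fun u hu ↦ by
      rw [SimpleGraph.Walk.support_map, List.mem_map] at hu
      obtain ⟨x, hx, rfl⟩ := hu
      exact hX g x (hq x hx)⟩
  have hpF {s : G} (hs : s ∈ S) {u : T.V} (hu : u ∈ (p s).support) : u ∈ F :=
    Or.inr (Set.mem_biUnion (Finset.mem_coe.2 hs) hu)
  have hRw (g : G) : R w (g • w) := by
    have hg : g ∈ Subgroup.closure (S : Set G) := hS ▸ Subgroup.mem_top g
    induction hg using Subgroup.closure_induction with
    | mem s hs => exact ⟨p s, fun u hu ↦ hFX (hpF hs hu)⟩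
    | one => exact ⟨(SimpleGraph.Walk.nil : T.graph.Walk w w).copy rfl (one_smul G w).symm, by
        simpa using hFX (Set.mem_insert w _)⟩
    | mul g h _ _ hg hh => exact hRtrans hg (by simpa only [mul_smul] using hRsmul g hh)
    | inv g _ hg => exact hRsymm (by simpa only [inv_smul_smul] using hRsmul g⁻¹ hg)
  have hRF (u : T.V) (hu : u ∈ F) : R w u := by
    classical
    rcases hu with rfl | hu
    · simpa using hRw 1
    · obtain ⟨s, hs, hu⟩ := Set.mem_iUnion₂.1 hu
      exact ⟨(p s).takeUntil u hu, fun x hx ↦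
        hFX (hpF hs ((p s).support_takeUntil_subset_support hu hx))⟩
  have hRX (v : T.V) (hv : v ∈ X) : R w v := by
    obtain ⟨g, hg⟩ := hv
    exact hRtrans (hRw g⁻¹) (by simpa only [inv_smul_smul] using hRsmul g⁻¹ (hRF _ hg))
  have hwX : w ∈ X := hFX (Set.mem_insert w _)
  have hconn : (T.graph.induce X).Connected :=
    (SimpleGraph.connected_iff_exists_forall_reachable _).2
      ⟨⟨w, hwX⟩, fun ⟨v, hv⟩ ↦ (hRX v hv).elim fun q hq ↦ ⟨q.induce X hq⟩⟩
  have huniv : X = Set.univ := T.minimal X ⟨w, hwX⟩ hX hconn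
  exact ⟨F, hF, fun v ↦ (huniv ▸ Set.mem_univ v : v ∈ X)⟩

lemma IsCollapseMap.dominates {T T' : GTree G} {f : T.V → T'.V} (hf : IsCollapseMap T T' f) :
    T.Dominates T' := fun _ ⟨w, hw⟩ ↦ ⟨f w, fun h hh ↦ by rw [← hf.1, hw h hh]⟩

/-- If every element of `G` elliptic in a collapse of `T` is elliptic in `T`, then the collapse
dominates `T`. -/
lemma IsCollapseMap.dominates_of_elliptic (hfg : Group.FG G) {T T' : GTree G} {f : T.V → T'.V}
    (hf : IsCollapseMap T T' f) (hell : ∀ g : G, T'.EllipticElt g → T.EllipticElt g) :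
    T'.Dominates T := by
  rintro K ⟨v, hv⟩
  have hmem (h : T'.vertexStab v) (y : T.V) (hy : y ∈ f ⁻¹' {v}) :
      (h : G) • y ∈ f ⁻¹' {v} := by
    have h₁ : f ((h : G) • y) = T'.act h (f y) := hf.1 h y
    rw [Set.mem_preimage, Set.mem_singleton_iff] at hy ⊢
    rw [h₁, hy]
    exact h.2
  let : MulAction (T'.vertexStab v) (f ⁻¹' {v}) :=
    { smul := fun h y ↦ ⟨(h : G) • (y : T.V), hmem h y y.2⟩
      one_smul := fun y ↦ Subtype.ext (one_smul G (y : T.V))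
      mul_smul := fun g h y ↦ Subtype.ext (mul_smul (g : G) (h : G) (y : T.V)) }
  obtain ⟨F, hF, hFG⟩ := T.exists_finite_smul_mem hfg
  have := hF.to_subtype
  choose t ht using hFG
  have htree : (T.graph.induce (f ⁻¹' {v})).IsTree := ⟨hf.2.2.2 v, T.acyclic.induce _⟩
  have hellY (h : T'.vertexStab v) : ∃ y : f ⁻¹' {v}, h • y = y := by
    obtain ⟨p, hp⟩ := hell h ⟨v, h.2⟩
    obtain ⟨y, hyS, hy⟩ := T.isTree.exists_mem_smul_eq T.adj_smul (hf.2.2.2 v) (hmem h) hp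
    exact ⟨⟨y, hyS⟩, Subtype.ext hy⟩
  let c (y : f ⁻¹' {v}) : F := ⟨t y • (y : T.V), ht y⟩
  have hc (a b : f ⁻¹' {v}) (hab : c a = c b) : ∃ h : T'.vertexStab v, h • a = b := by
    have h₁ : t a • (a : T.V) = t b • (b : T.V) := congrArg Subtype.val hab
    have h₂ : ((t b)⁻¹ * t a) • (a : T.V) = b := by rw [mul_smul, h₁, inv_smul_smul]
    have h₃ : f (((t b)⁻¹ * t a) • (a : T.V)) = T'.act ((t b)⁻¹ * t a) (f a) := hf.1 _ _
    have ha : f a = v := a.2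
    have hb : f b = v := b.2
    rw [h₂, ha, hb] at h₃
    exact ⟨⟨(t b)⁻¹ * t a, h₃.symm⟩, Subtype.ext h₂⟩
  obtain ⟨y, hy⟩ := htree.exists_fixed_of_forall_elliptic
    (fun (h : T'.vertexStab v) a b ↦ T.adj_smul h a b) hellY c hc
  exact ⟨y, fun k hk ↦ congrArg Subtype.val (hy ⟨k, hv k hk⟩)⟩

end GTree

/-- if `T₁` collapses onto `T₂` and they are not in the same deformation
space, some element of `G` is hyperbolic in `T₁` and elliptic in `T₂`. -/
theorem collapse_hyperbolic {G : Type u} [Group G] (hfg : Group.FG G)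
    (T₁ T₂ : GTree G) (f : T₁.V → T₂.V) (hf : GTree.IsCollapseMap T₁ T₂ f)
    (hnds : ¬(T₁.Dominates T₂ ∧ T₂.Dominates T₁)) :
    ∃ g : G, ¬T₁.EllipticElt g ∧ T₂.EllipticElt g := by
  by_contra! h
  exact hnds ⟨hf.dominates, hf.dominates_of_elliptic hfg fun g hg ↦
    by_contra fun hg' ↦ h g hg' hg⟩
end

section
/- Let T be a G-tree and let E₁, E₂ be disjoint G-invariant sets of edges of T whose union is the set of all edges of T. Let p₁ : T → T₁ and p₂ : T → T₂ be collapse maps such that the set of edges of T collapsed by p₁ is exactly E₁ and the set of edges collapsed by p₂ is exactly E₂. Then: (1) every subgroup of G that is elliptic in both T₁ and T₂ is elliptic in T; (2) every G-tree T' that dominates both T₁ and T₂ dominates T. -/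
universe u v

namespace SimpleGraph

variable {V : Type*} {Γ : SimpleGraph V}

/-- Two vertices of a set spanning a preconnected subgraph are joined by a path in the set. -/
lemma exists_isPath_support_subset {A : Set V} (hA : (Γ.induce A).Preconnected) {a a' : V}
    (ha : a ∈ A) (ha' : a' ∈ A) :
    ∃ p : Γ.Walk a a', p.IsPath ∧ ∀ x ∈ p.support, x ∈ A := by
  obtain ⟨q, hq⟩ := (hA ⟨a, ha⟩ ⟨a', ha'⟩).exists_isPath
  refine ⟨q.map (Embedding.induce (G := Γ) A).toHom,
    hq.map (Embedding.induce (G := Γ) A).injective, fun x hx => ?_⟩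
  obtain ⟨y, -, rfl⟩ := List.mem_map.1
    ((congrArg (x ∈ ·) (q.support_map (Embedding.induce (G := Γ) A).toHom)).mp hx)
  exact y.2

/-- A vertex of a geodesic which is at least as far from the end as the start is the start. -/
lemma Walk.eq_of_mem_support_of_dist_le {a b x : V} (w : Γ.Walk a b)
    (hw : w.length = Γ.dist a b) (hx : x ∈ w.support) (hd : Γ.dist a b ≤ Γ.dist x b) :
    x = a := by
  classical
  have h := congrArg Walk.length (w.take_spec hx)
  rw [Walk.length_append] at h
  have h' := dist_le (w.dropUntil x hx)
  exact (Walk.eq_of_length_eq_zero (p := w.takeUntil x hx) (by omega)).symm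

/-- In a tree, let `A` and `B` be subtrees with no common edge. Then two pairs realizing the
distance between `A` and `B` have the same endpoint in `A`. -/
lemma IsAcyclic.eq_of_dist_minimal (hΓ : Γ.IsAcyclic) (hconn : Γ.Connected) {A B : Set V}
    (hA : (Γ.induce A).Preconnected) (hB : (Γ.induce B).Preconnected)
    (hAB : ∀ x y, Γ.Adj x y → x ∈ A → y ∈ A → x ∈ B → y ∉ B)
    {a a' b b' : V} (ha : a ∈ A) (ha' : a' ∈ A) (hb : b ∈ B) (hb' : b' ∈ B)
    (hmin : ∀ x ∈ A, ∀ y ∈ B, Γ.dist a b ≤ Γ.dist x y)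
    (hmin' : ∀ x ∈ A, ∀ y ∈ B, Γ.dist a' b' ≤ Γ.dist x y) : a = a' := by
  obtain ⟨p, hp, hpA⟩ := exists_isPath_support_subset hA ha ha'
  obtain ⟨q, -, hqB⟩ := exists_isPath_support_subset hB hb hb'
  obtain ⟨w, hw⟩ := hconn.exists_walk_length_eq_dist a b
  obtain ⟨w', hw'⟩ := hconn.exists_walk_length_eq_dist a' b'
  cases p with
  | nil => rfl
  | @cons _ c _ hac p =>
    exfalso
    rw [Walk.cons_isPath_iff] at hp
    have hc : c ∈ A := hpA c (by simp)
    have hmem := isBridge_iff_forall_walk_mem_edges.1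
      (isAcyclic_iff_forall_isBridge.1 hΓ ((Γ.mem_edgeSet).2 hac))
      ((w.append q).append (w'.reverse.append p.reverse))
    simp only [Walk.edges_append, Walk.edges_reverse, List.mem_append, List.mem_reverse] at hmem
    rcases hmem with (h | h) | h | h
    · exact hac.ne' (w.eq_of_mem_support_of_dist_le hw (w.snd_mem_support_of_mem_edges h)
        (hmin c hc b hb))
    · exact hAB a c hac ha hc (hqB _ (q.fst_mem_support_of_mem_edges h))
        (hqB _ (q.snd_mem_support_of_mem_edges h))
    · have h₁ := w'.eq_of_mem_support_of_dist_le hw' (w'.fst_mem_support_of_mem_edges h)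
        (hmin' a ha b' hb')
      have h₂ := w'.eq_of_mem_support_of_dist_le hw' (w'.snd_mem_support_of_mem_edges h)
        (hmin' c hc b' hb')
      exact hac.ne (h₁.trans h₂.symm)
    · exact hp.2 (p.fst_mem_support_of_mem_edges h)

end SimpleGraph

namespace GTree

variable {G : Type u} [Group G]

lemma dist_act_le (T : GTree G) (g : G) (a b : T.V) :
    T.graph.dist (T.act g a) (T.act g b) ≤ T.graph.dist a b := by
  obtain ⟨w, hw⟩ := T.connected.exists_walk_length_eq_dist a b
  let φ : T.graph →g T.graph := ⟨T.act g, fun h => T.act_adj g _ _ h⟩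
  rw [← hw, ← SimpleGraph.Walk.length_map φ w]
  exact SimpleGraph.dist_le (w.map φ)

/-- A subgroup preserving two subtrees with no common edge is elliptic. -/
lemma ellipticSubgroup_of_invariant_subtrees (T : GTree G) (H : Subgroup G) {A B : Set T.V}
    (hA : (T.graph.induce A).Connected) (hB : (T.graph.induce B).Connected)
    (hAH : ∀ h ∈ H, ∀ x ∈ A, T.act h x ∈ A) (hBH : ∀ h ∈ H, ∀ x ∈ B, T.act h x ∈ B)
    (hAB : ∀ x y, T.graph.Adj x y → x ∈ A → y ∈ A → x ∈ B → y ∉ B) :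
    T.EllipticSubgroup H := by
  obtain ⟨⟨a₀, ha₀⟩⟩ := hA.nonempty
  obtain ⟨⟨b₀, hb₀⟩⟩ := hB.nonempty
  obtain ⟨⟨a, b⟩, ⟨ha, hb⟩, hmin⟩ := exists_minimalFor_of_wellFoundedLT
    (fun z : T.V × T.V => z.1 ∈ A ∧ z.2 ∈ B) (fun z => T.graph.dist z.1 z.2) ⟨(a₀, b₀), ha₀, hb₀⟩
  have hmin' : ∀ x ∈ A, ∀ y ∈ B, T.graph.dist a b ≤ T.graph.dist x y := fun x hx y hy =>
    (le_total (T.graph.dist a b) (T.graph.dist x y)).elim id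
      fun h => hmin (j := (x, y)) ⟨hx, hy⟩ h
  refine ⟨a, fun h hh => ?_⟩
  exact (T.acyclic.eq_of_dist_minimal T.connected hA.preconnected hB.preconnected hAB ha
    (hAH h hh a ha) hb (hBH h hh b hb) hmin'
    fun x hx y hy => (T.dist_act_le h a b).trans (hmin' x hx y hy)).symm

end GTree

/-- collapsing complementary invariant edge sets. -/
theorem collapse_complementary {G : Type u} [Group G] (hfg : Group.FG G)
    (T T₁ T₂ : GTree G) (E₁ E₂ : Set (Sym2 T.V))
    (hdisj : Disjoint E₁ E₂) (hunion : E₁ ∪ E₂ = T.graph.edgeSet)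
    (hinv₁ : ∀ g : G, ∀ e ∈ E₁, Sym2.map (T.act g) e ∈ E₁)
    (hinv₂ : ∀ g : G, ∀ e ∈ E₂, Sym2.map (T.act g) e ∈ E₂)
    (p₁ : T.V → T₁.V) (p₂ : T.V → T₂.V)
    (hp₁ : GTree.IsCollapseMap T T₁ p₁) (hp₂ : GTree.IsCollapseMap T T₂ p₂)
    (hc₁ : ∀ a b : T.V, T.graph.Adj a b → (p₁ a = p₁ b ↔ s(a, b) ∈ E₁))
    (hc₂ : ∀ a b : T.V, T.graph.Adj a b → (p₂ a = p₂ b ↔ s(a, b) ∈ E₂)) :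
    (∀ H : Subgroup G, T₁.EllipticSubgroup H → T₂.EllipticSubgroup H →
      T.EllipticSubgroup H) ∧
    ∀ T' : GTree G, T'.Dominates T₁ → T'.Dominates T₂ → T'.Dominates T := by
  have key : ∀ H : Subgroup G, T₁.EllipticSubgroup H → T₂.EllipticSubgroup H →
      T.EllipticSubgroup H := by
    rintro H ⟨v₁, hv₁⟩ ⟨v₂, hv₂⟩
    refine T.ellipticSubgroup_of_invariant_subtrees H (hp₁.2.2.2 v₁) (hp₂.2.2.2 v₂) ?_ ?_ ?_
    · rintro h hh x rfl
      exact (hp₁.1 h x).trans (hv₁ h hh)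
    · rintro h hh x rfl
      exact (hp₂.1 h x).trans (hv₂ h hh)
    · intro x y hxy hx₁ hy₁ hx₂ hy₂
      exact Set.disjoint_left.1 hdisj ((hc₁ x y hxy).1 (hx₁.trans hy₁.symm))
        ((hc₂ x y hxy).1 (hx₂.trans hy₂.symm))
  exact ⟨key, fun T' h₁ h₂ H hH => key H (h₁ H hH) (h₂ H hH)⟩
end
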